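/- For all homogeneous A, A_1, …, A_p, B_1, …, B_q in W the higher pre-Jacobi identity holds: A{A_1,…,A_p}{B_1,…,B_q} = Σ (−1)^ε A{B_1,…,B_{k_1}, A_1{B_{k_1+1},…,B_{l_1}}, B_{l_1+1},…,B_{k_2}, A_2{B_{k_2+1},…,B_{l_2}}, …, B_{k_p}, A_p{B_{k_p+1},…,B_{l_p}}, B_{l_p+1},…,B_q}, where the sum runs over all index sequences 0 ≤ k_1 ≤ l_1 ≤ k_2 ≤ l_2 ≤ ⋯ ≤ k_p ≤ l_p ≤ q (i.e. over all shuffles of the A's and B's in which each A_i receives a possibly empty consecutive block of the B's, with the relative order of the A's and of the B's preserved), and ε = Σ_{i=1}^{p} |A_i|(|B_1|+⋯+|B_{k_i}|). -/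

import Mathlib

namespace Ainf

variable (k : Type*) [Field k] [CharZero k]
variable (V : ℤ → Type*) [∀ l, AddCommGroup (V l)] [∀ l, Module k (V l)]

/-- Homogeneous elements of `V`, tagged with their degree. -/
abbrev HV := Σ l : ℤ, V l

/-- Total degree of a list of homogeneous elements. -/
def degSum (vs : List (HV V)) : ℤ := (vs.map Sigma.fst).sum

/-- Cast between homogeneous components (junk value `0` if the degrees differ;
in all intended uses the degrees provably agree). -/
def vcast {a b : ℤ} (x : V a) : V b := if h : a = b then h ▸ x else 0

/-- A homogeneous degree-`d` element of `Hom(T(V),V)`, encoded by its values on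
tuples (lists) of homogeneous elements of `V`. -/
abbrev E (d : ℤ) := (vs : List (HV V)) → V (d + degSum V vs)

/-- Multilinearity (over `k`, in each slot) of a graded map: this singles out the
elements of `W = Hom(T(V),V)` among all functions on homogeneous tuples. -/
def IsMultilinear {d : ℤ} (f : E V d) : Prop :=
  (∀ (xs zs : List (HV V)) (l : ℤ) (x y : V l),
      (vcast V (f (xs ++ ⟨l, x + y⟩ :: zs)) : V (d + degSum V xs + l + degSum V zs)) =
        vcast V (f (xs ++ ⟨l, x⟩ :: zs)) + vcast V (f (xs ++ ⟨l, y⟩ :: zs))) ∧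
  (∀ (xs zs : List (HV V)) (l : ℤ) (c : k) (x : V l),
      (vcast V (f (xs ++ ⟨l, c • x⟩ :: zs)) : V (d + degSum V xs + l + degSum V zs)) =
        c • vcast V (f (xs ++ ⟨l, x⟩ :: zs)))

/-- All splittings of a list into two consecutive parts. -/
def splits2 {α : Type*} (vs : List α) : List (List α × List α) :=
  (List.range (vs.length + 1)).map fun i => (vs.take i, vs.drop i)

/-- All splittings of a list into three consecutive parts. -/
def splits3 {α : Type*} (vs : List α) : List (List α × List α × List α) :=
  (splits2 vs).flatMap fun p => (splits2 p.2).map fun q => (p.1, q.1, q.2)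

/-- The Gerstenhaber composition product
`(f∘g)(v₁,…) = Σᵢ (−1)^{|g|(|v₁|+⋯+|vᵢ|)} f(v₁,…,vᵢ,g(v_{i+1},…),…)`. -/
def gcomp {a b : ℤ} (f : E V a) (g : E V b) : E V (a + b) := fun vs =>
  ((splits3 vs).map fun p =>
    ((-1 : k) ^ (b * degSum V p.1)) •
      vcast V (f (p.1 ++ ⟨b + degSum V p.2.1, g p.2.1⟩ :: p.2.2))).sum

/-- Degree recast of a graded map (junk when the degrees differ). -/
def recast {a b : ℤ} (f : E V a) : E V b := fun vs => vcast V (f vs)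

/-- The Gerstenhaber bracket `[f,g] = f∘g − (−1)^{|f||g|} g∘f`. -/
def gbr {a b : ℤ} (f : E V a) (g : E V b) : E V (a + b) :=
  gcomp k V f g - ((-1 : k) ^ (a * b)) • recast V (gcomp k V g f)

/-- A homogeneous element of `W`, packaged with its degree. -/
abbrev GE := Σ d : ℤ, E V d

/-- Total degree of a list of homogeneous elements of `W`. -/
def degl (As : List (GE V)) : ℤ := (As.map Sigma.fst).sum

/-- Auxiliary enumeration of all ordered disjoint insertions of the operations `Bs`
into a tuple `vs`, together with the Koszul sign exponents
`ε = Σᵢ |Bᵢ|(|v₁|+⋯+|v_{kᵢ}|)`. -/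
def ins : List (GE V) → List (HV V) → List (ℤ × List (HV V))
  | [], vs => [(0, vs)]
  | B :: Bs, vs =>
    (splits3 vs).flatMap fun p =>
      (ins Bs p.2.2).map fun q =>
        (B.1 * degSum V p.1 + degl V Bs * (degSum V p.1 + degSum V p.2.1) + q.1,
          p.1 ++ ⟨B.1 + degSum V p.2.1, B.2 p.2.1⟩ :: q.2)

/-- The brace operations `A{A₁,…,Aₚ}`. -/
def braces {a : ℤ} (A : E V a) (As : List (GE V)) : E V (a + degl V As) := fun vs =>
  ((ins V As vs).map fun q => ((-1 : k) ^ q.1) • vcast V (A q.2)).sum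

/-- Enumeration of all `A`/`B`-shuffles occurring on the right-hand side of the higher
pre-Jacobi identity: each `Aᵢ` receives a (possibly empty) consecutive block of the `B`'s,
orders preserved, with sign exponents `ε = Σᵢ |Aᵢ|(|B₁|+⋯+|B_{kᵢ}|)`. -/
def insG : List (GE V) → List (GE V) → List (ℤ × List (GE V))
  | [], Bs => [(0, Bs)]
  | A :: As, Bs =>
    (splits3 Bs).flatMap fun p =>
      (insG As p.2.2).map fun q =>
        (A.1 * degl V p.1 + degl V As * (degl V p.1 + degl V p.2.1) + q.1,
          p.1 ++ ⟨A.1 + degl V p.2.1, braces k V A.2 p.2.1⟩ :: q.2)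

set_option linter.unusedSectionVars false

section Splits

variable {α β M : Type*} [AddCommMonoid M]

/-- The sum of `f x y` over all splittings `l = x ++ y`. -/
def sum2 (l : List α) (f : List α → List α → M) : M :=
  ((splits2 l).map fun p => f p.1 p.2).sum

theorem append_eq_of_mem_splits2 {l : List α} {p : List α × List α} (hp : p ∈ splits2 l) :
    p.1 ++ p.2 = l := by
  obtain ⟨i, -, rfl⟩ := List.mem_map.1 hp
  exact List.take_append_drop i l

theorem splits2_cons (a : α) (l : List α) :
    splits2 (a :: l) = ([], a :: l) :: (splits2 l).map fun p => (a :: p.1, p.2) := by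
  simp [splits2, List.range_succ_eq_map, Function.comp_def]

theorem sum2_nil (f : List α → List α → M) : sum2 [] f = f [] [] := by
  simp [sum2, splits2]

theorem sum2_cons (a : α) (l : List α) (f : List α → List α → M) :
    sum2 (a :: l) f = f [] (a :: l) + sum2 l fun x y => f (a :: x) y := by
  simp [sum2, splits2_cons, Function.comp_def]

theorem sum2_congr {l : List α} {f g : List α → List α → M}
    (h : ∀ x y, x ++ y = l → f x y = g x y) : sum2 l f = sum2 l g := by
  unfold sum2
  congr 1
  exact List.map_congr_left fun p hp => h _ _ (append_eq_of_mem_splits2 hp)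

theorem sum2_add (l : List α) (f g : List α → List α → M) :
    (sum2 l fun x y => f x y + g x y) = sum2 l f + sum2 l g :=
  List.sum_map_add

theorem sum_map_comm (l : List α) (m : List β) (f : α → β → M) :
    (l.map fun a => (m.map fun b => f a b).sum).sum =
      (m.map fun b => (l.map fun a => f a b).sum).sum := by
  induction l with
  | nil => simp
  | cons a l ih => simp [ih, List.sum_map_add]

theorem smul_sum_map {R : Type*} [Monoid R] [DistribMulAction R M] (c : R) (l : List α)
    (f : α → M) : c • (l.map f).sum = (l.map fun a => c • f a).sum := by
  rw [List.smul_sum, List.map_map]; rfl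

theorem smul_sum2 {R : Type*} [Monoid R] [DistribMulAction R M] (c : R) (l : List α)
    (f : List α → List α → M) : c • sum2 l f = sum2 l fun x y => c • f x y :=
  smul_sum_map ..

theorem sum2_comm (l : List α) (m : List β) (f : List α → List α → List β → List β → M) :
    (sum2 l fun x y => sum2 m fun z w => f x y z w) =
      sum2 m fun z w => sum2 l fun x y => f x y z w :=
  sum_map_comm ..

theorem sum_map_sum2 (l : List α) (m : List β) (f : List α → List α → β → M) :
    (m.map fun b => sum2 l fun x y => f x y b).sum =
      sum2 l fun x y => (m.map fun b => f x y b).sum :=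
  sum_map_comm ..

theorem sum2_assoc (l : List α) (f : List α → List α → List α → M) :
    (sum2 l fun x r => sum2 r fun y z => f x y z) =
      sum2 l fun s z => sum2 s fun x y => f x y z := by
  induction l generalizing f with
  | nil => simp [sum2_nil]
  | cons a l ih => simp [sum2_cons, sum2_nil, ih, sum2_add, add_assoc]

theorem sum2_assoc₄ (l : List α) (f : List α → List α → List α → List α → M) :
    (sum2 l fun x r => sum2 r fun y s => sum2 s fun z w => f x y z w) =
      sum2 l fun t w => sum2 t fun x r => sum2 r fun y z => f x y z w := by
  rw [← sum2_assoc l fun x r w => sum2 r fun y z => f x y z w]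
  simp only [sum2_assoc]

theorem sum2_append_cons (u : List α) (b : α) (q : List α) (f : List α → List α → M) :
    sum2 (u ++ b :: q) f =
      (sum2 u fun x y => f x (y ++ b :: q)) + sum2 q fun x y => f (u ++ b :: x) y := by
  induction u generalizing f with
  | nil => simp [sum2_nil, sum2_cons]
  | cons a u ih => simp [sum2_cons, ih, add_assoc]

theorem sum_map_splits3 (l : List α) (f : List α × List α × List α → M) :
    ((splits3 l).map f).sum = sum2 l fun x r => sum2 r fun y z => f (x, y, z) := by
  simp [splits3, sum2, List.flatMap_def, List.map_flatten, Function.comp_def]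

theorem sum_map_flatMap_splits3 (l : List α) (g : List α × List α × List α → List β)
    (f : β → M) :
    (((splits3 l).flatMap g).map f).sum =
      sum2 l fun x r => sum2 r fun y z => ((g (x, y, z)).map f).sum := by
  rw [List.map_flatMap, List.flatMap_def, List.sum_flatten, List.map_map, sum_map_splits3]
  rfl

end Splits

theorem sum_map_apply {ι α : Type*} {N : α → Type*} [∀ i, AddCommMonoid (N i)] (l : List ι)
    (f : ι → ∀ i, N i) (i : α) : (l.map f).sum i = (l.map fun j => f j i).sum := by
  induction l with
  | nil => rfl
  | cons j l ih => simp [ih]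

section Degrees

variable {V}

theorem degSum_append (x y : List (HV V)) : degSum V (x ++ y) = degSum V x + degSum V y := by
  simp [degSum]

theorem degSum_cons (b : HV V) (x : List (HV V)) :
    degSum V (b :: x) = b.1 + degSum V x := by
  simp [degSum]

theorem degl_append (x y : List (GE V)) : degl V (x ++ y) = degl V x + degl V y := by
  simp [degl]

theorem degl_cons (B : GE V) (x : List (GE V)) : degl V (B :: x) = B.1 + degl V x := by
  simp [degl]

theorem append_eq_of_mem_splits3 {α : Type*} {l : List α} {p : List α × List α × List α}
    (hp : p ∈ splits3 l) : p.1 ++ (p.2.1 ++ p.2.2) = l := by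
  obtain ⟨s, hs, hp⟩ := List.mem_flatMap.1 hp
  obtain ⟨t, ht, rfl⟩ := List.mem_map.1 hp
  dsimp only
  rw [append_eq_of_mem_splits2 ht, append_eq_of_mem_splits2 hs]

theorem degSum_of_mem_ins {Bs : List (GE V)} {vs : List (HV V)} {q : ℤ × List (HV V)}
    (hq : q ∈ ins V Bs vs) : degSum V q.2 = degl V Bs + degSum V vs := by
  induction Bs generalizing vs q with
  | nil =>
    obtain rfl := List.mem_singleton.1 hq
    simp [degl]
  | cons B Bs ih =>
    obtain ⟨p, hp, hq⟩ := List.mem_flatMap.1 hq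
    obtain ⟨r, hr, rfl⟩ := List.mem_map.1 hq
    rw [← append_eq_of_mem_splits3 hp]
    simp only [degSum_append, degSum_cons, degl_cons, ih hr]
    ring

variable {k} in
theorem degl_of_mem_insG {As Bs : List (GE V)} {g : ℤ × List (GE V)}
    (hg : g ∈ insG k V As Bs) : degl V g.2 = degl V As + degl V Bs := by
  induction As generalizing Bs g with
  | nil =>
    obtain rfl := List.mem_singleton.1 hg
    simp [degl]
  | cons A As ih =>
    obtain ⟨p, hp, hg⟩ := List.mem_flatMap.1 hg
    obtain ⟨r, hr, rfl⟩ := List.mem_map.1 hg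
    rw [← append_eq_of_mem_splits3 hp]
    simp only [degl_append, degl_cons, ih hr]
    ring

theorem vcast_add {a b : ℤ} (x y : V a) :
    (vcast V (x + y) : V b) = vcast V x + vcast V y := by
  unfold vcast
  split
  · subst b; rfl
  · simp

variable {k} in
theorem vcast_smul {a b : ℤ} (c : k) (x : V a) :
    (vcast V (c • x) : V b) = c • vcast V x := by
  unfold vcast
  split
  · subst b; rfl
  · simp

theorem vcast_sum {α : Type*} {a b : ℤ} (l : List α) (f : α → V a) :
    (vcast V (l.map f).sum : V b) = (l.map fun i => vcast V (f i)).sum := by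
  induction l with
  | nil => unfold vcast; split <;> [(subst b; rfl); rfl]
  | cons i l ih => simp [vcast_add, ih]

theorem vcast_vcast {a b c : ℤ} (h : a = b) (x : V a) :
    (vcast V (vcast V x : V b) : V c) = vcast V x := by
  subst h
  simp [vcast]

theorem mk_vcast {a b : ℤ} (h : a = b) (x : V a) :
    (⟨b, vcast V x⟩ : HV V) = ⟨a, x⟩ := by
  subst h
  simp [vcast]

end Degrees

section Insertions

variable {V} {M : Type*} [AddCommGroup M] [Module k M]

/-- The signed sum of `F` over all insertions of the operations `Bs` into `vs`. -/
def insSum (Bs : List (GE V)) (vs : List (HV V)) (F : List (HV V) → M) : M :=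
  ((ins V Bs vs).map fun q => (-1 : k) ^ q.1 • F q.2).sum

variable {k} in
theorem sign_smul_smul (m n : ℤ) (x : M) :
    (-1 : k) ^ m • (-1 : k) ^ n • x = (-1 : k) ^ (m + n) • x := by
  rw [smul_smul, zpow_add₀ (neg_ne_zero.2 one_ne_zero)]

theorem insSum_congr {Bs : List (GE V)} {vs : List (HV V)} {F G : List (HV V) → M}
    (h : ∀ w, degSum V w = degl V Bs + degSum V vs → F w = G w) :
    insSum k Bs vs F = insSum k Bs vs G := by
  unfold insSum
  congr 1
  exact List.map_congr_left fun q hq => by rw [h _ (degSum_of_mem_ins hq)]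

theorem insSum_nil (vs : List (HV V)) (F : List (HV V) → M) :
    insSum k [] vs F = F vs := by
  simp [insSum, ins]

theorem insSum_cons (B : GE V) (Bs : List (GE V)) (vs : List (HV V))
    (F : List (HV V) → M) :
    insSum k (B :: Bs) vs F = sum2 vs fun x r => sum2 r fun y z =>
      (-1 : k) ^ (B.1 * degSum V x + degl V Bs * (degSum V x + degSum V y)) •
        insSum k Bs z fun q => F (x ++ ⟨B.1 + degSum V y, B.2 y⟩ :: q) := by
  simp only [insSum, ins, sum_map_flatMap_splits3, List.map_map, Function.comp_def,
    smul_sum_map, sign_smul_smul]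

theorem insSum_add (Bs : List (GE V)) (vs : List (HV V)) (F G : List (HV V) → M) :
    (insSum k Bs vs fun w => F w + G w) = insSum k Bs vs F + insSum k Bs vs G := by
  simp only [insSum, smul_add, List.sum_map_add]

theorem insSum_smul (Bs : List (GE V)) (vs : List (HV V)) (c : k) (F : List (HV V) → M) :
    (insSum k Bs vs fun w => c • F w) = c • insSum k Bs vs F := by
  simp only [insSum, smul_sum_map, smul_comm c]

theorem insSum_sum_map {α : Type*} (Bs : List (GE V)) (vs : List (HV V)) (l : List α)
    (F : α → List (HV V) → M) :
    (insSum k Bs vs fun w => (l.map fun i => F i w).sum) =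
      (l.map fun i => insSum k Bs vs (F i)).sum := by
  simp only [insSum, smul_sum_map]
  exact sum_map_comm ..

theorem insSum_sum2 {α : Type*} (Bs : List (GE V)) (vs : List (HV V)) (l : List α)
    (F : List α → List α → List (HV V) → M) :
    (insSum k Bs vs fun w => sum2 l fun x y => F x y w) =
      sum2 l fun x y => insSum k Bs vs (F x y) :=
  insSum_sum_map ..

theorem insSum_comm (Bs Cs : List (GE V)) (vs us : List (HV V))
    (F : List (HV V) → List (HV V) → M) :
    (insSum k Bs vs fun w => insSum k Cs us fun q => F w q) =
      insSum k Cs us fun q => insSum k Bs vs fun w => F w q := by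
  conv_lhs => simp only [insSum.eq_1 k Cs us]
  rw [insSum_sum_map]
  simp only [insSum_smul]
  rfl

/-- Cutting the result of an insertion in two amounts to cutting both the operations and
the arguments in two. -/
theorem insSum_sum2_self (Bs : List (GE V)) (vs : List (HV V))
    (G : List (HV V) → List (HV V) → M) :
    (insSum k Bs vs fun w => sum2 w fun x y => G x y) =
      sum2 Bs fun B₁ B₂ => sum2 vs fun v₁ v₂ =>
        (-1 : k) ^ (degl V B₂ * degSum V v₁) •
          insSum k B₁ v₁ fun x => insSum k B₂ v₂ fun y => G x y := by
  induction Bs generalizing vs G with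
  | nil => simp [sum2_nil, insSum_nil, degl]
  | cons B Bs ih =>
    rw [sum2_cons]
    simp only [insSum_cons, insSum_nil, sum2_append_cons, insSum_add, smul_add, sum2_add,
      smul_sum2, insSum_sum2, ih]
    congr 1
    · conv_rhs => rw [sum2_assoc vs]
      refine sum2_congr fun x y _ => ?_
      rw [sum2_comm]
      refine sum2_congr fun x₁ x₂ hx => sum2_congr fun y₁ y₂ _ => ?_
      rw [sign_smul_smul, ← hx, degSum_append, degl_cons]
      congr 2
      ring
    · simp only [sum2_comm _ Bs, sign_smul_smul, sum2_assoc₄]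
      refine sum2_congr fun B₁ B₂ hB => sum2_congr fun v w _ => sum2_congr fun x r hv =>
        sum2_congr fun y z hr => ?_
      rw [← hB, ← hv, ← hr]
      simp only [degSum_append, degl_append]
      congr 2
      ring

/-- An insertion of `Bs ++ X :: Cs` is determined by the arguments of `X`. -/
theorem insSum_append_cons (Bs : List (GE V)) (X : GE V) (Cs : List (GE V))
    (vs : List (HV V)) (F : List (HV V) → M) :
    insSum k (Bs ++ X :: Cs) vs F = sum2 vs fun x r => sum2 r fun y z =>
      (-1 : k) ^ (X.1 * degSum V x + degl V Cs * (degSum V x + degSum V y)) •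
        insSum k Bs x fun w => insSum k Cs z fun q =>
          F (w ++ ⟨X.1 + degSum V y, X.2 y⟩ :: q) := by
  induction Bs generalizing vs F with
  | nil => simp only [List.nil_append, insSum_cons, insSum_nil]
  | cons B Bs ih =>
    simp only [List.cons_append, insSum_cons, ih, smul_sum2, sign_smul_smul]
    rw [sum2_assoc₄ vs]
    refine sum2_congr fun v w _ => ?_
    simp only [sum2_comm w, List.cons_append, List.append_assoc]
    refine sum2_congr fun x r hv => sum2_congr fun y z hr => sum2_congr fun u t _ => ?_
    rw [← hv, ← hr]
    simp only [degSum_append, degl_append, degl_cons]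
    congr 2
    ring

/-- Multilinear functions on tuples of homogeneous elements. -/
structure Multilin (Φ : List (HV V) → M) : Prop where
  map_add : ∀ (xs zs : List (HV V)) (l : ℤ) (x y : V l),
    Φ (xs ++ ⟨l, x + y⟩ :: zs) = Φ (xs ++ ⟨l, x⟩ :: zs) + Φ (xs ++ ⟨l, y⟩ :: zs)
  map_smul : ∀ (xs zs : List (HV V)) (l : ℤ) (c : k) (x : V l),
    Φ (xs ++ ⟨l, c • x⟩ :: zs) = c • Φ (xs ++ ⟨l, x⟩ :: zs)

variable {k}

theorem Multilin.map_sum {Φ : List (HV V) → M} (hΦ : Multilin k Φ) {α : Type*}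
    (xs zs : List (HV V)) (l : ℤ) (m : List α) (f : α → V l) :
    Φ (xs ++ ⟨l, (m.map f).sum⟩ :: zs) = (m.map fun i => Φ (xs ++ ⟨l, f i⟩ :: zs)).sum := by
  induction m with
  | nil => simpa using hΦ.map_smul xs zs l 0 0
  | cons i m ih => simp [hΦ.map_add, ih]

theorem Multilin.map_braces {Φ : List (HV V) → M} (hΦ : Multilin k Φ)
    (xs zs : List (HV V)) (A : GE V) (Bs : List (GE V)) (vs : List (HV V)) :
    Φ (xs ++ ⟨A.1 + degl V Bs + degSum V vs, braces k V A.2 Bs vs⟩ :: zs) =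
      insSum k Bs vs fun w => Φ (xs ++ ⟨A.1 + degSum V w, A.2 w⟩ :: zs) := by
  rw [braces, hΦ.map_sum, insSum]
  congr 1
  refine List.map_congr_left fun q hq => ?_
  rw [hΦ.map_smul, mk_vcast]
  rw [degSum_of_mem_ins hq, add_assoc]

theorem Multilin.of_append_cons {Φ : List (HV V) → M} (hΦ : Multilin k Φ)
    (us : List (HV V)) (b : HV V) : Multilin k fun zs => Φ (us ++ b :: zs) where
  map_add xs zs l x y := by simpa using hΦ.map_add (us ++ b :: xs) zs l x y
  map_smul xs zs l c x := by simpa using hΦ.map_smul (us ++ b :: xs) zs l c x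

theorem IsMultilinear.multilin {d e : ℤ} {f : E V d} (hf : IsMultilinear k V f) :
    Multilin k fun vs => (vcast V (f vs) : V e) := by
  have hd (xs zs : List (HV V)) (l : ℤ) (x : V l) :
      d + degSum V (xs ++ ⟨l, x⟩ :: zs) = d + degSum V xs + l + degSum V zs := by
    simp only [degSum_append, degSum_cons]
    ring
  constructor
  · intro xs zs l x y
    have h := congrArg (vcast V (b := e)) (hf.1 xs zs l x y)
    rwa [vcast_add, vcast_vcast (hd ..), vcast_vcast (hd ..), vcast_vcast (hd ..)] at h
  · intro xs zs l c x
    have h := congrArg (vcast V (b := e)) (hf.2 xs zs l c x)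
    rwa [vcast_smul, vcast_vcast (hd ..), vcast_vcast (hd ..)] at h

theorem insSum_insSum {Φ : List (HV V) → M} (hΦ : Multilin k Φ) (As Bs : List (GE V))
    (vs : List (HV V)) :
    (insSum k Bs vs fun w => insSum k As w Φ) =
      ((insG k V As Bs).map fun g => (-1 : k) ^ g.1 • insSum k g.2 vs Φ).sum := by
  induction As generalizing Bs vs Φ with
  | nil => simp [insSum_nil, insG]
  | cons A As ih =>
    have key (B₁ B₂ B₃ : List (GE V)) (v₁ v₂ v₃ : List (HV V)) :
        (insSum k B₁ v₁ fun w₁ => insSum k B₂ v₂ fun w₂ =>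
          (-1 : k) ^ (A.1 * degSum V w₁ + degl V As * (degSum V w₁ + degSum V w₂)) •
            insSum k B₃ v₃ fun w₃ => insSum k As w₃ fun q =>
              Φ (w₁ ++ ⟨A.1 + degSum V w₂, A.2 w₂⟩ :: q)) =
        (-1 : k) ^ (A.1 * (degl V B₁ + degSum V v₁) +
            degl V As * (degl V B₁ + degSum V v₁ + (degl V B₂ + degSum V v₂))) •
          ((insG k V As B₃).map fun g => (-1 : k) ^ g.1 •
            insSum k B₁ v₁ fun w₁ => insSum k g.2 v₃ fun q =>
              Φ (w₁ ++ ⟨A.1 + degl V B₂ + degSum V v₂, braces k V A.2 B₂ v₂⟩ :: q)).sum := by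
      trans insSum k B₁ v₁ fun w₁ => insSum k B₂ v₂ fun w₂ =>
        (-1 : k) ^ (A.1 * (degl V B₁ + degSum V v₁) +
            degl V As * (degl V B₁ + degSum V v₁ + (degl V B₂ + degSum V v₂))) •
          ((insG k V As B₃).map fun g => (-1 : k) ^ g.1 •
            insSum k g.2 v₃ fun q => Φ (w₁ ++ ⟨A.1 + degSum V w₂, A.2 w₂⟩ :: q)).sum
      · refine insSum_congr k fun w₁ h₁ => insSum_congr k fun w₂ h₂ => ?_
        rw [h₁, ← h₂, ih (hΦ.of_append_cons _ _)]
      · simp only [insSum_smul, insSum_sum_map, hΦ.map_braces, insSum_comm k _ B₂]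
    have lhs : (insSum k Bs vs fun w => insSum k (A :: As) w Φ) =
        sum2 Bs fun B₁ R => sum2 R fun B₂ B₃ => sum2 vs fun v₁ r => sum2 r fun v₂ v₃ =>
          (-1 : k) ^ (degl V R * degSum V v₁ + degl V B₃ * degSum V v₂) •
          insSum k B₁ v₁ fun w₁ => insSum k B₂ v₂ fun w₂ =>
            (-1 : k) ^ (A.1 * degSum V w₁ + degl V As * (degSum V w₁ + degSum V w₂)) •
              insSum k B₃ v₃ fun w₃ => insSum k As w₃ fun q =>
                Φ (w₁ ++ ⟨A.1 + degSum V w₂, A.2 w₂⟩ :: q) := by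
      simp only [insSum_cons, insSum_sum2_self, insSum_sum2, insSum_smul, smul_sum2,
        sign_smul_smul]
      refine sum2_congr fun B₁ R _ => ?_
      exact sum2_comm ..
    rw [lhs]
    simp only [key, insG, sum_map_flatMap_splits3, List.map_map, Function.comp_def,
      insSum_append_cons, smul_sum2, sum_map_sum2, smul_sum_map, sign_smul_smul]
    refine sum2_congr fun B₁ R _ => sum2_congr fun B₂ B₃ hR => sum2_congr fun v₁ r _ =>
      sum2_congr fun v₂ v₃ _ => congrArg List.sum (List.map_congr_left fun g hg => ?_)
    rw [← hR, degl_of_mem_insG hg, degl_append]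
    congr 2
    ring

end Insertions

/-- The higher pre-Jacobi identity for the brace operations:
`A{A₁,…,Aₚ}{B₁,…,B_q} = Σ_{AB-shuffles} (−1)^ε A{B₁,…,A₁{B_{k₁+1},…},…,Aₚ{…},…,B_q}`. -/
theorem braces_pre_jacobi (a : ℤ) (A : E V a) (As Bs : List (GE V))
    (hA : IsMultilinear k V A)
    (hAs : ∀ X ∈ As, IsMultilinear k V X.2)
    (hBs : ∀ X ∈ Bs, IsMultilinear k V X.2) :
    (recast V (braces k V (braces k V A As) Bs) : E V (a + degl V As + degl V Bs)) =
      ((insG k V As Bs).map fun q =>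
        (((-1 : k) ^ q.1) • recast V (braces k V A q.2) :
          E V (a + degl V As + degl V Bs))).sum := by
  funext vs
  have key (Cs : List (GE V)) (D : ℤ) (ws : List (HV V)) :
      (vcast V (braces k V A Cs ws) : V D) = insSum k Cs ws fun r => vcast V (A r) := by
    rw [braces, vcast_sum]
    unfold insSum
    congr 1
    refine List.map_congr_left fun q hq => ?_
    rw [vcast_smul, vcast_vcast]
    rw [degSum_of_mem_ins hq, add_assoc]
  have lhs : recast V (braces k V (braces k V A As) Bs) vs =
      insSum k Bs vs fun w => insSum k As w fun r =>
        (vcast V (A r) : V (a + degl V As + degl V Bs + degSum V vs)) := by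
    rw [recast, braces, vcast_sum]
    unfold insSum
    congr 1
    refine List.map_congr_left fun q hq => ?_
    rw [vcast_smul, vcast_vcast, key]
    · rfl
    · rw [degSum_of_mem_ins hq, add_assoc (a + _)]
  rw [lhs, insSum_insSum hA.multilin, sum_map_apply]
  simp only [Pi.smul_apply, recast, key]

end Ainf
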